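/- arXiv:1812.11732 — 2 statements merged into one kernel-verified Lean document; each statement's English description precedes it below -/
import Mathlib

section
/- Let m = (∫_{1/8}^{3/8} x·e^{-x²/2} dx) / (∫_{1/8}^{3/8} e^{-x²/2} dx), i.e., the mean of a standard Gaussian random variable conditioned on lying in [1/8, 3/8]. Then m > 0 and |1/4 − m| < m/100. -/
theorem aux_exp_upper (t : ℝ) (ht : 0 ≤ t) : Real.exp (-t) ≤ 1 - t + t ^ 2 / 2 := by
  have h := Real.quadratic_le_exp_of_nonneg ht
  have hp : 0 < Real.exp t := Real.exp_pos t
  rw [Real.exp_neg, inv_le_iff_one_le_mul₀ hp]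
  have h2 : 0 ≤ 1 - t + t ^ 2 / 2 := by nlinarith [sq_nonneg (t - 1)]
  have h3 := mul_le_mul_of_nonneg_left h h2
  nlinarith [sq_nonneg (t ^ 2)]

theorem aux_low (x : ℝ) : 1 - x ^ 2 / 2 ≤ Real.exp (-x ^ 2 / 2) := by
  have := Real.add_one_le_exp (-x ^ 2 / 2)
  linarith

theorem aux_upp (x : ℝ) : Real.exp (-x ^ 2 / 2) ≤ 1 - x ^ 2 / 2 + x ^ 4 / 8 := by
  have := aux_exp_upper (x ^ 2 / 2) (by positivity)
  rw [show -x ^ 2 / 2 = -(x ^ 2 / 2) by ring]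
  linarith [show (x ^ 2 / 2) ^ 2 / 2 = x ^ 4 / 8 by ring]

theorem aux_int (a b c d e : ℝ) :
    ∫ x in (1 / 8 : ℝ)..(3 / 8 : ℝ), (a + b * x + c * x ^ 2 + d * x ^ 3 + e * x ^ 4 ) =
      a / 4 + b / 16 + c * (13 / 768) + d * (5 / 1024) + e * (121 / 81920) := by
  have h : ∀ x ∈ Set.uIcc (1 / 8 : ℝ) (3 / 8), HasDerivAt
      (fun x : ℝ => a * x + b * (x ^ 2 / 2) + c * (x ^ 3 / 3) + d * (x ^ 4 / 4) + e * (x ^ 5 / 5))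
      (a + b * x + c * x ^ 2 + d * x ^ 3 + e * x ^ 4) x := by
    intro x _
    have h1 := (hasDerivAt_id' x).const_mul a
    have h2 := ((hasDerivAt_pow 2 x).div_const 2).const_mul b
    have h3 := ((hasDerivAt_pow 3 x).div_const 3).const_mul c
    have h4 := ((hasDerivAt_pow 4 x).div_const 4).const_mul d
    have h5 := ((hasDerivAt_pow 5 x).div_const 5).const_mul e
    refine ((((h1.add h2).add h3).add h4).add h5).congr_deriv ?_
    norm_num
  rw [intervalIntegral.integral_eq_sub_of_hasDerivAt h
    (Continuous.intervalIntegrable (by fun_prop) _ _)]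
  ring

theorem aux_mono (f g : ℝ → ℝ) (hf : Continuous f) (hg : Continuous g)
    (h : ∀ x, 0 ≤ x → f x ≤ g x) :
    ∫ x in (1 / 8 : ℝ)..(3 / 8 : ℝ), f x ≤ ∫ x in (1 / 8 : ℝ)..(3 / 8 : ℝ), g x :=
  intervalIntegral.integral_mono_on (by norm_num) (hf.intervalIntegrable _ _)
    (hg.intervalIntegrable _ _) (fun x hx => h x (by linarith [hx.1]))

theorem stmt_7
    (m : ℝ)
    (hm : m = (∫ x in (1 / 8 : ℝ)..(3 / 8 : ℝ), x * Real.exp (-x ^ 2 / 2)) /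
        (∫ x in (1 / 8 : ℝ)..(3 / 8 : ℝ), Real.exp (-x ^ 2 / 2))) :
    0 < m ∧ |1 / 4 - m| < m / 100 := by
  have B1 := aux_mono (fun x => 1 + 0 * x + (-1 / 2) * x ^ 2 + 0 * x ^ 3 + 0 * x ^ 4)
    (fun x => Real.exp (-x ^ 2 / 2)) (by fun_prop) (by fun_prop)
    (fun x _ => by linarith [aux_low x])
  have B2 := aux_mono (fun x => Real.exp (-x ^ 2 / 2))
    (fun x => 1 + 0 * x + (-1 / 2) * x ^ 2 + 0 * x ^ 3 + (1 / 8) * x ^ 4)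
    (by fun_prop) (by fun_prop) (fun x _ => by linarith [aux_upp x])
  have A1 := aux_mono (fun x => 0 + 1 * x + 0 * x ^ 2 + (-1 / 2) * x ^ 3 + 0 * x ^ 4)
    (fun x => x * Real.exp (-x ^ 2 / 2)) (by fun_prop) (by fun_prop)
    (fun x hx => by nlinarith [mul_le_mul_of_nonneg_left (aux_low x) hx])
  -- on `[1/8, 3/8]`, `x ^ 5 ≤ (3/8) x ^ 4`
  have A2 : ∫ x in (1 / 8 : ℝ)..(3 / 8 : ℝ), x * Real.exp (-x ^ 2 / 2) ≤
      ∫ x in (1 / 8 : ℝ)..(3 / 8 : ℝ),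
        (0 + 1 * x + 0 * x ^ 2 + (-1 / 2) * x ^ 3 + (3 / 64) * x ^ 4) := by
    refine intervalIntegral.integral_mono_on (by norm_num)
      (Continuous.intervalIntegrable (by fun_prop) _ _)
      (Continuous.intervalIntegrable (by fun_prop) _ _) (fun x hx => ?_)
    have hx0 : 0 ≤ x := by linarith [hx.1]
    have h1 := mul_le_mul_of_nonneg_left (aux_upp x) hx0
    have h2 : x ^ 4 * x ≤ x ^ 4 * (3 / 8) := mul_le_mul_of_nonneg_left hx.2 (by positivity)
    nlinarith
  simp only [aux_int] at A1 A2 B1 B2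
  generalize (∫ x in (1 / 8 : ℝ)..(3 / 8 : ℝ), x * Real.exp (-x ^ 2 / 2)) = A at *
  generalize (∫ x in (1 / 8 : ℝ)..(3 / 8 : ℝ), Real.exp (-x ^ 2 / 2)) = B at *
  have hB : 0 < B := by linarith
  have hl : 25 / 101 < m := by
    rw [hm, lt_div_iff₀ hB]; linarith
  have hu : m < 25 / 99 := by
    rw [hm, div_lt_iff₀ hB]; linarith
  refine ⟨by linarith, ?_⟩
  rw [abs_lt]
  constructor <;> linarith
end

section
/- Let σ > 0 and Δ = σ/4, let X be a real random variable with the Gaussian distribution of mean 0 and variance σ², and let μ = E[X | Δ/2 ≤ X ≤ 3Δ/2]. Then μ > 0 and |Δ − μ| < μ/100. -/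
open MeasureTheory ProbabilityTheory
open scoped NNReal

/-- The rescaled density, recentred at the quantization step. -/
noncomputable def gdens (t : ℝ) : ℝ := Real.exp (-(t ^ 2 / 2 + t / 4))

lemma gdens_cont : Continuous gdens := by unfold gdens; fun_prop

lemma J0_pos : 0 < ∫ t in (-1/8 : ℝ)..(1/8), gdens t := by
  apply intervalIntegral.intervalIntegral_pos_of_pos
  · exact gdens_cont.intervalIntegrable _ _
  · intro t; exact Real.exp_pos _
  · norm_num

lemma J1_nonpos : ∫ t in (-1/8 : ℝ)..(1/8), t * gdens t ≤ 0 := by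
  have h0 : ∫ t in (-1/8 : ℝ)..(1/8), t = 0 := by
    rw [integral_id]; norm_num
  rw [← h0]
  apply intervalIntegral.integral_mono_on
  · norm_num
  · exact (continuous_id.mul gdens_cont).intervalIntegrable _ _
  · exact continuous_id.intervalIntegrable _ _
  · rintro t ⟨h1, h2⟩
    unfold gdens
    rcases le_total 0 t with ht | ht
    · have : Real.exp (-(t ^ 2 / 2 + t / 4)) ≤ 1 := by
        apply Real.exp_le_one_iff.2; nlinarith [sq_nonneg t]
      nlinarith
    · have : 1 ≤ Real.exp (-(t ^ 2 / 2 + t / 4)) := by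
        apply Real.one_le_exp; nlinarith
      nlinarith

lemma J_comb : 0 < ∫ t in (-1/8 : ℝ)..(1/8), (101/100 * t + 1/400) * gdens t := by
  have h0 : 0 < ∫ t in (-1/8 : ℝ)..(1/8), ((101/100 * t + 1/400) * (1 - (t ^ 2 / 2 + t / 4))
      - 13/100 * (t ^ 2 / 2 + t / 4) ^ 2) := by
    have e : ∀ t : ℝ, ((101/100 * t + 1/400) * (1 - (t ^ 2 / 2 + t / 4))
      - 13/100 * (t ^ 2 / 2 + t / 4) ^ 2) = 1/400 * t^0 + (101/100 - 1/1600) * t^1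
        + (-101/400 - 1/800 - 13/1600) * t^2 + (-101/200 - 13/400) * t^3 + (-13/400) * t^4 := by
      intro t; ring
    simp_rw [e]
    rw [intervalIntegral.integral_add, intervalIntegral.integral_add,
      intervalIntegral.integral_add, intervalIntegral.integral_add]
    · simp only [intervalIntegral.integral_const_mul, integral_pow]
      norm_num
    all_goals exact Continuous.intervalIntegrable (by fun_prop) _ _
  refine h0.trans_le ?_
  apply intervalIntegral.integral_mono_on
  · norm_num
  · exact Continuous.intervalIntegrable (by fun_prop) _ _
  · exact Continuous.intervalIntegrable (by have := gdens_cont; fun_prop) _ _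
  · rintro t ⟨h1, h2⟩
    unfold gdens
    have hu : |(-(t ^ 2 / 2 + t / 4))| ≤ 1 := by
      rw [abs_le]; constructor <;> nlinarith
    have hb := Real.abs_exp_sub_one_sub_id_le hu
    have hc : |101/100 * t + 1/400| ≤ 13/100 := by
      rw [abs_le]; constructor <;> linarith
    have hm := mul_le_mul hc hb (abs_nonneg _) (by norm_num)
    rw [← abs_mul] at hm
    have := (abs_le.1 hm).1
    nlinarith

lemma setInt_gauss (σ : ℝ) (hσ : 0 < σ) (h : ℝ → ℝ) :
    ∫ x in Set.Icc (σ / 4 / 2) (3 * (σ / 4) / 2), h x ∂(gaussianReal 0 ⟨σ ^ 2, sq_nonneg σ⟩)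
    = σ * ((√(2 * Real.pi * σ ^ 2))⁻¹ * Real.exp (-1/32)) *
      ∫ t in (-1/8 : ℝ)..(1/8), h (σ * t + σ / 4) * gdens t := by
  have hv : (⟨σ ^ 2, sq_nonneg σ⟩ : ℝ≥0) ≠ 0 := by
    intro hh
    have := congrArg NNReal.toReal hh
    have h2 : σ ^ 2 = 0 := this
    exact (pow_pos hσ 2).ne' h2
  rw [← integral_indicator measurableSet_Icc, integral_gaussianReal_eq_integral_smul hv]
  have e : (fun x => gaussianPDFReal 0 ⟨σ ^ 2, sq_nonneg σ⟩ x •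
      (Set.Icc (σ / 4 / 2) (3 * (σ / 4) / 2)).indicator h x) =
      (Set.Icc (σ / 4 / 2) (3 * (σ / 4) / 2)).indicator
        (fun x => gaussianPDFReal 0 ⟨σ ^ 2, sq_nonneg σ⟩ x * h x) := by
    funext x
    by_cases hx : x ∈ Set.Icc (σ / 4 / 2) (3 * (σ / 4) / 2) <;> simp [hx]
  rw [e, integral_indicator measurableSet_Icc, integral_Icc_eq_integral_Ioc,
    ← intervalIntegral.integral_of_le (by linarith)]
  have s := intervalIntegral.integral_comp_mul_add (a := -1/8) (b := 1/8)
    (fun x => gaussianPDFReal 0 ⟨σ ^ 2, sq_nonneg σ⟩ x * h x) hσ.ne' (σ / 4)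
  rw [show σ * (-1/8) + σ / 4 = σ / 4 / 2 by ring,
    show σ * (1/8) + σ / 4 = 3 * (σ / 4) / 2 by ring, smul_eq_mul,
    eq_inv_mul_iff_mul_eq₀ hσ.ne'] at s
  rw [← s, mul_assoc]
  congr 1
  rw [← intervalIntegral.integral_const_mul]
  congr 1
  funext t
  have hp : gaussianPDFReal 0 ⟨σ ^ 2, sq_nonneg σ⟩ (σ * t + σ / 4) =
      (√(2 * Real.pi * σ ^ 2))⁻¹ * (Real.exp (-1/32) * gdens t) := by
    unfold gaussianPDFReal gdens
    rw [← Real.exp_add]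
    change (√(2 * Real.pi * σ ^ 2))⁻¹ * Real.exp (-(σ * t + σ / 4 - 0) ^ 2 / (2 * σ ^ 2)) = _
    congr 2
    field_simp
    ring
  rw [hp]; ring

theorem stmt_8 (σ Δ μq : ℝ) (hσ : 0 < σ) (hΔ : Δ = σ / 4)
    (hμq : μq =
      (∫ x in Set.Icc (Δ / 2) (3 * Δ / 2), x ∂(gaussianReal 0 ⟨σ ^ 2, sq_nonneg σ⟩)) /
        ((gaussianReal 0 ⟨σ ^ 2, sq_nonneg σ⟩) (Set.Icc (Δ / 2) (3 * Δ / 2))).toReal) :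
    0 < μq ∧ |Δ - μq| < μq / 100 := by
  subst hΔ
  have hN := setInt_gauss σ hσ (fun x => x)
  have hD := setInt_gauss σ hσ (fun _ => 1)
  simp only [integral_const, smul_eq_mul, mul_one, one_mul, Measure.real,
    Measure.restrict_apply_univ] at hD
  rw [hN, hD] at hμq
  have h0 := J0_pos
  have h1 := J1_nonpos
  have hc := J_comb
  have i0 : IntervalIntegrable gdens volume (-1/8) (1/8) := gdens_cont.intervalIntegrable _ _
  have i1 : IntervalIntegrable (fun t => t * gdens t) volume (-1/8) (1/8) :=
    (continuous_id.mul gdens_cont).intervalIntegrable _ _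
  have lin : ∀ a b : ℝ, ∫ t in (-1/8 : ℝ)..(1/8), (a * t + b) * gdens t =
      a * (∫ t in (-1/8 : ℝ)..(1/8), t * gdens t) + b * ∫ t in (-1/8 : ℝ)..(1/8), gdens t := by
    intro a b
    rw [← intervalIntegral.integral_const_mul, ← intervalIntegral.integral_const_mul,
      ← intervalIntegral.integral_add (i1.const_mul a) (i0.const_mul b)]
    congr 1; funext t; ring
  rw [lin] at hc hμq
  have hK : 0 < σ * ((√(2 * Real.pi * σ ^ 2))⁻¹ * Real.exp (-1/32)) := by
    have := Real.pi_pos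
    positivity
  rw [mul_div_mul_left _ _ hK.ne'] at hμq
  generalize (∫ t in (-1/8 : ℝ)..(1/8), t * gdens t) = A at *
  generalize (∫ t in (-1/8 : ℝ)..(1/8), gdens t) = B at *
  have hμ2 : μq = σ * (A / B + 1 / 4) := by rw [hμq]; field_simp
  have r1 : A / B ≤ 0 := div_nonpos_of_nonpos_of_nonneg h1 h0.le
  have r2 : 0 < 101/100 * (A / B) + 1/400 := by
    have : 101/100 * (A / B) + 1/400 = (101/100 * A + 1/400 * B) / B := by field_simp
    rw [this]; positivity
  generalize A / B = r at *
  subst hμ2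
  have p1 := mul_pos hσ r2
  have p2 : σ * r ≤ 0 := mul_nonpos_of_nonneg_of_nonpos hσ.le r1
  refine ⟨by nlinarith, ?_⟩
  rw [abs_lt]
  constructor <;> nlinarith
end
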